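/- Let U ⊆ ℝ be an open interval, let Ω : U → ℝ be four times differentiable with Ω'(z) ≠ 0 for all z ∈ U, and define B := -(1/2){Ω,z}. Let a, b, c, d be real constants with ad - bc ≠ 0 such that (a·Ω(z) + b)(c·Ω(z) + d) ≠ 0 for all z ∈ U. Then: (i) the function w := (a·Ω + b)(c·Ω + d)/((ad - bc)·Ω') satisfies the linear equation w''' - 4B·w' - 2B'·w = 0 on U; (ii) for any real constant r, if u : U → ℝ is twice differentiable, nonvanishing on U, and satisfies u² = 2r·(a·Ω + b)(c·Ω + d)/((ad - bc)·Ω') on U, then u satisfies the Ermakov equation u'' = B·u - r²/u³ on U; (iii) the function y := -(3/2)·((ad - bc)·Ω'/((a·Ω + b)(c·Ω + d)))² satisfies the Painlevé XXV–Ermakov equation with A = 0, y·y'' - (5/4)(y')² + (2/3)y³ + 4B·y² = 0, on U. -/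

import Mathlib

/-- General solutions from the Schwarzian equation: with
w = (aΩ + b)(cΩ + d)/((ad - bc)Ω'), the linear equation w''' - 4B·w' - 2B'·w = 0, the
Ermakov equation u'' = B·u - r²/u³ (via u² = 2r·w), and the Painlevé XXV–Ermakov equation
with A = 0 (via y = -(3/2)((ad - bc)Ω'/((aΩ + b)(cΩ + d)))²) are all solved. -/
theorem general_solutions_from_schwarzian
    (U : Set ℝ) (hU : IsOpen U) (hUconn : IsConnected U)
    (Ω B : ℝ → ℝ) (a b c d : ℝ)
    (hΩ : ∀ z ∈ U, DifferentiableAt ℝ Ω z)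
    (hΩ' : ∀ z ∈ U, DifferentiableAt ℝ (deriv Ω) z)
    (hΩ'' : ∀ z ∈ U, DifferentiableAt ℝ (deriv (deriv Ω)) z)
    (hΩ''' : ∀ z ∈ U, DifferentiableAt ℝ (deriv (deriv (deriv Ω))) z)
    (hΩ'ne : ∀ z ∈ U, deriv Ω z ≠ 0)
    (hB : B = fun z => -(1 / 2) * (deriv (deriv (deriv Ω)) z / deriv Ω z
      - 3 / 2 * (deriv (deriv Ω) z / deriv Ω z) ^ 2))
    (hdet : a * d - b * c ≠ 0)
    (hne : ∀ z ∈ U, (a * Ω z + b) * (c * Ω z + d) ≠ 0) :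
    (∀ z ∈ U,
      deriv (deriv (deriv (fun t =>
        (a * Ω t + b) * (c * Ω t + d) / ((a * d - b * c) * deriv Ω t)))) z
      - 4 * B z * deriv (fun t =>
        (a * Ω t + b) * (c * Ω t + d) / ((a * d - b * c) * deriv Ω t)) z
      - 2 * deriv B z
        * ((a * Ω z + b) * (c * Ω z + d) / ((a * d - b * c) * deriv Ω z)) = 0) ∧
    (∀ r : ℝ, ∀ u : ℝ → ℝ,
      (∀ z ∈ U, DifferentiableAt ℝ u z) →
      (∀ z ∈ U, DifferentiableAt ℝ (deriv u) z) →
      (∀ z ∈ U, u z ≠ 0) →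
      (∀ z ∈ U, (u z) ^ 2 =
        2 * r * ((a * Ω z + b) * (c * Ω z + d) / ((a * d - b * c) * deriv Ω z))) →
      ∀ z ∈ U, deriv (deriv u) z = B z * u z - r ^ 2 / (u z) ^ 3) ∧
    (∀ z ∈ U,
      (fun t => -(3 / 2)
        * ((a * d - b * c) * deriv Ω t / ((a * Ω t + b) * (c * Ω t + d))) ^ 2) z
      * deriv (deriv (fun t => -(3 / 2)
        * ((a * d - b * c) * deriv Ω t / ((a * Ω t + b) * (c * Ω t + d))) ^ 2)) z
      - 5 / 4 * (deriv (fun t => -(3 / 2)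
        * ((a * d - b * c) * deriv Ω t / ((a * Ω t + b) * (c * Ω t + d))) ^ 2) z) ^ 2
      + 2 / 3 * ((fun t => -(3 / 2)
        * ((a * d - b * c) * deriv Ω t / ((a * Ω t + b) * (c * Ω t + d))) ^ 2) z) ^ 3
      + 4 * B z * ((fun t => -(3 / 2)
        * ((a * d - b * c) * deriv Ω t / ((a * Ω t + b) * (c * Ω t + d))) ^ 2) z) ^ 2
      = 0) := by
  classical
  set w : ℝ → ℝ := fun t =>
    (a * Ω t + b) * (c * Ω t + d) / ((a * d - b * c) * deriv Ω t) with hw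
  set w1 : ℝ → ℝ := fun t =>
    (a * (c * Ω t + d) + c * (a * Ω t + b)) / (a * d - b * c)
      - (a * Ω t + b) * (c * Ω t + d) * deriv (deriv Ω) t
        / ((a * d - b * c) * (deriv Ω t) ^ 2) with hw1
  set w2 : ℝ → ℝ := fun t => 2 * B t * w t + ((w1 t) ^ 2 - 1) / (2 * w t) with hw2
  have hwne : ∀ z ∈ U, w z ≠ 0 := fun z hz =>
    div_ne_zero (hne z hz) (mul_ne_zero hdet (hΩ'ne z hz))
  have D1 : ∀ z ∈ U, HasDerivAt w (w1 z) z := by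
    intro z hz
    have h0 := (hΩ z hz).hasDerivAt
    have h1 := (hΩ' z hz).hasDerivAt
    have hq := hΩ'ne z hz
    have := (((h0.const_mul a).add_const b).mul ((h0.const_mul c).add_const d)).div
      (h1.const_mul (a * d - b * c)) (mul_ne_zero hdet hq)
    refine this.congr_deriv ?_
    simp only [hw1, Pi.mul_apply]
    field_simp
  have D2 : ∀ z ∈ U, HasDerivAt w1 (w2 z) z := by
    intro z hz
    have h0 := (hΩ z hz).hasDerivAt
    have h1 := (hΩ' z hz).hasDerivAt
    have h2 := (hΩ'' z hz).hasDerivAt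
    have hq := hΩ'ne z hz
    have hP : a * Ω z + b ≠ 0 := left_ne_zero_of_mul (hne z hz)
    have hQ : c * Ω z + d ≠ 0 := right_ne_zero_of_mul (hne z hz)
    have hP' := (h0.const_mul a).add_const b
    have hQ' := (h0.const_mul c).add_const d
    have := (((hQ'.const_mul a).add (hP'.const_mul c)).div_const (a * d - b * c)).sub
      (((hP'.mul hQ').mul h2).div ((h1.pow 2).const_mul (a * d - b * c))
        (mul_ne_zero hdet (pow_ne_zero 2 hq)))
    refine this.congr_deriv ?_
    simp only [hw2, hw1, hw, hB, Pi.mul_apply, Pi.pow_apply]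
    generalize deriv (deriv (deriv Ω)) z = s
    generalize deriv (deriv Ω) z = r at *
    generalize deriv Ω z = q at *
    have hΔ : a * d - b * c = a * (c * Ω z + d) - c * (a * Ω z + b) := by ring
    clear this hP' hQ' h0 h1 h2
    generalize a * d - b * c = Δ at *
    generalize a * Ω z + b = P at *
    generalize c * Ω z + d = Q at *
    field_simp
    rw [hΔ]
    ring
  have DB : ∀ z ∈ U, DifferentiableAt ℝ B z := by
    intro z hz
    rw [hB]
    have h1 := hΩ' z hz
    have h2 := hΩ'' z hz
    have h3 := hΩ''' z hz
    have hq := hΩ'ne z hz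
    exact ((h3.div h1 hq).sub (((h2.div h1 hq).pow 2).const_mul _)).const_mul _
  have D3 : ∀ z ∈ U, HasDerivAt w2 (4 * B z * w1 z + 2 * deriv B z * w z) z := by
    intro z hz
    have hz0 := hwne z hz
    have := (((DB z hz).hasDerivAt.const_mul 2).mul (D1 z hz)).add
      ((((D2 z hz).pow 2).sub_const 1).div ((D1 z hz).const_mul 2)
        (mul_ne_zero two_ne_zero hz0))
    refine this.congr_deriv ?_
    have e : w2 z = 2 * B z * w z + ((w1 z) ^ 2 - 1) / (2 * w z) := rfl
    simp only [Pi.pow_apply]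
    rw [e]
    generalize w z = x at *
    generalize w1 z = y at *
    field_simp
    ring
  have E1 : ∀ z ∈ U, deriv w =ᶠ[nhds z] w1 := fun z hz =>
    Filter.eventuallyEq_of_mem (hU.mem_nhds hz) (fun t ht => (D1 t ht).deriv)
  have E2 : ∀ z ∈ U, deriv (deriv w) =ᶠ[nhds z] w2 := fun z hz =>
    Filter.eventuallyEq_of_mem (hU.mem_nhds hz)
      (fun t ht => ((E1 t ht).deriv_eq).trans (D2 t ht).deriv)
  refine ⟨?_, ?_, ?_⟩
  · intro z hz
    rw [(E2 z hz).deriv_eq, (D3 z hz).deriv, (D1 z hz).deriv]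
    change 4 * B z * w1 z + 2 * deriv B z * w z - 4 * B z * w1 z - 2 * deriv B z * w z = 0
    ring
  · intro r u hu hu' hune hsq z hz
    have hsq' : ∀ t ∈ U, u t ^ 2 = 2 * r * w t := hsq
    have F1 : ∀ t ∈ U, u t * deriv u t = r * w1 t := by
      intro t ht
      have e : (fun t => u t ^ 2) =ᶠ[nhds t] fun t => 2 * r * w t :=
        Filter.eventuallyEq_of_mem (hU.mem_nhds ht) hsq'
      have h1 := ((hu t ht).hasDerivAt.pow 2).unique
        (((D1 t ht).const_mul (2 * r)).congr_of_eventuallyEq e)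
      norm_num at h1
      linarith
    have e : (fun t => u t * deriv u t) =ᶠ[nhds z] fun t => r * w1 t :=
      Filter.eventuallyEq_of_mem (hU.mem_nhds hz) F1
    have F2 := ((hu z hz).hasDerivAt.mul (hu' z hz).hasDerivAt).unique
        (((D2 z hz).const_mul r).congr_of_eventuallyEq e)
    have F0 := hsq' z hz
    have G1 := F1 z hz
    have hu0 := hune z hz
    have hz0 := hwne z hz
    have K : 2 * w z * w2 z = 4 * B z * w z ^ 2 + w1 z ^ 2 - 1 := by
      have e : w2 z = 2 * B z * w z + ((w1 z) ^ 2 - 1) / (2 * w z) := rfl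
      rw [e]
      field_simp
      ring
    have key : deriv (deriv u) z * u z ^ 3 = B z * u z ^ 4 - r ^ 2 := by
      linear_combination u z ^ 2 * F2 + (r * w2 z - B z * (u z ^ 2 + 2 * r * w z)) * F0
        - (u z * deriv u z + r * w1 z) * G1 + r ^ 2 * K
    field_simp
    linear_combination key
  · intro z hz
    have hy : (fun t => -(3 / 2)
        * ((a * d - b * c) * deriv Ω t / ((a * Ω t + b) * (c * Ω t + d))) ^ 2)
        = fun t => -(3 / 2) * ((w t)⁻¹) ^ 2 := by
      funext t
      simp only [hw, inv_div]
    rw [hy]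
    have Y1 : ∀ t ∈ U, HasDerivAt (fun t => -(3 / 2) * ((w t)⁻¹) ^ 2)
        (3 * w1 t * ((w t)⁻¹) ^ 3) t := by
      intro t ht
      have hz0 := hwne t ht
      refine ((((D1 t ht).inv hz0).pow 2).const_mul (-(3 / 2))).congr_deriv ?_
      simp only [Pi.inv_apply, Nat.add_one_sub_one, Nat.reduceSub, Nat.cast_ofNat, pow_one]
      generalize w t = x at *
      field_simp
    have EY : deriv (fun t => -(3 / 2) * ((w t)⁻¹) ^ 2) =ᶠ[nhds z]
        fun t => 3 * w1 t * ((w t)⁻¹) ^ 3 :=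
      Filter.eventuallyEq_of_mem (hU.mem_nhds hz) (fun t ht => (Y1 t ht).deriv)
    have hz0 := hwne z hz
    have Y2 := ((D2 z hz).const_mul 3).mul (((D1 z hz).inv hz0).pow 3)
    rw [EY.deriv_eq, (Y1 z hz).deriv]
    have Y3 : deriv (fun t => 3 * w1 t * ((w t)⁻¹) ^ 3) z = _ := Y2.deriv
    rw [Y3]
    have e : w2 z = 2 * B z * w z + ((w1 z) ^ 2 - 1) / (2 * w z) := rfl
    simp only [Pi.inv_apply, Pi.pow_apply, Nat.reduceSub, Nat.cast_ofNat]
    rw [e]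
    generalize w z = x at *
    generalize w1 z = y at *
    field_simp
    ring
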